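/- arXiv:2005.06573 — 4 statements merged into one kernel-verified Lean document; each statement's English description precedes it below -/
import Mathlib

section
/- Suppose the null hypothesis holds, i.e. μ is the product of its d marginals, and let T : 𝒳^n → ℝ be any measurable statistic. Define the permutation p-value p_D = (n!)^{−(d−1)} · #{permutation vectors ψ : T(ψD) ≥ T(D)} (the identity vector is included in the count, so p_D ≥ (n!)^{−(d−1)}). Then for every α ∈ [0,1], the probability that p_D ≤ α is at most α; i.e. the permutation test enumerating all (n!)^{d−1} permutation vectors has correct type 1 error rate. -/
open MeasureTheory ProbabilityTheory Filter
open scoped ENNReal Classical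

/-- The action of a permutation vector `ψ = (ψ^1, …, ψ^{d-1})` on a dataset:
the first coordinate is kept fixed and coordinate `j+1` is permuted by `ψ^j`. -/
def permAct {d n : ℕ} {𝒳 : Fin d → Type*} (ψ : Fin (d-1) → Equiv.Perm (Fin n))
    (D : Fin n → ∀ j, 𝒳 j) : Fin n → ∀ j, 𝒳 j :=
  fun i j => if h : j.val = 0 then D i j
    else D ((ψ ⟨j.val - 1, by have := j.isLt; omega⟩) i) j

/-- At most `c` indices of a finite family have at most `c` indices above them. -/
theorem card_filter_card_ge_le {G : Type*} [Fintype G] (f : G → ℝ) {c : ℝ} (hc : 0 ≤ c) :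
    ((Finset.univ.filter
      (fun h => ((Finset.univ.filter (fun g => f g ≥ f h)).card : ℝ) ≤ c)).card : ℝ) ≤ c := by
  set S := Finset.univ.filter
    (fun h => ((Finset.univ.filter (fun g => f g ≥ f h)).card : ℝ) ≤ c)
  rcases S.eq_empty_or_nonempty with h | h
  · simpa [h] using hc
  · obtain ⟨m, hm, hmin⟩ := S.exists_min_image f h
    have hsub : S ⊆ Finset.univ.filter (fun g => f g ≥ f m) := fun g hg => by
      simpa using hmin g hg
    exact (Nat.cast_le.2 (Finset.card_le_card hsub)).trans (Finset.mem_filter.1 hm).2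

/-- Validity of the rank `p`-value of a statistic along the orbits of a finite group acting
(on the right) by measure-preserving maps. -/
theorem card_mul_measure_rank_le {Ω G : Type*} [MeasurableSpace Ω] [Group G] [Fintype G]
    (ν : Measure Ω) [IsProbabilityMeasure ν] (a : G → Ω → Ω)
    (hmul : ∀ g h x, a g (a h x) = a (h * g) x)
    (ha : ∀ g, MeasurePreserving (a g) ν ν) (T : Ω → ℝ) (hT : Measurable T)
    {c : ℝ} (hc : 0 ≤ c) :
    (Fintype.card G : ℝ≥0∞) *
      ν {x | ((Finset.univ.filter (fun g => T (a g x) ≥ T x)).card : ℝ) ≤ c}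
      ≤ ENNReal.ofReal c := by
  set A := {x | ((Finset.univ.filter (fun g => T (a g x) ≥ T x)).card : ℝ) ≤ c} with hA
  have hAm : MeasurableSet A := by
    simp only [hA, Finset.card_filter, Nat.cast_sum, Nat.cast_ite, Nat.cast_one, Nat.cast_zero]
    refine measurableSet_le (Finset.measurable_sum _ fun g _ => ?_) measurable_const
    exact Measurable.ite (measurableSet_le hT (hT.comp (ha g).measurable))
      measurable_const measurable_const
  have hmem : ∀ h x, a h x ∈ A ↔
      ((Finset.univ.filter (fun g => T (a g x) ≥ T (a h x))).card : ℝ) ≤ c := fun h x => by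
    have hcard : (Finset.univ.filter (fun g => T (a g (a h x)) ≥ T (a h x))).card =
        (Finset.univ.filter (fun g => T (a g x) ≥ T (a h x))).card := by
      refine Finset.card_equiv (Equiv.mulLeft h) fun g => ?_
      simp [hmul]
    simp only [hA, Set.mem_ofPred_eq, hcard]
  calc (Fintype.card G : ℝ≥0∞) * ν A = ∑ h : G, ν (a h ⁻¹' A) := by
        simp [(ha _).measure_preimage hAm.nullMeasurableSet]
    _ = ∫⁻ x, ∑ h : G, (a h ⁻¹' A).indicator 1 x ∂ν := by
        rw [lintegral_finsetSum _ fun h _ =>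
          measurable_one.indicator ((ha h).measurable hAm)]
        simp [lintegral_indicator_one ((ha _).measurable hAm)]
    _ ≤ ∫⁻ _, ENNReal.ofReal c ∂ν := by
        refine lintegral_mono fun x => ?_
        have hsum : ∑ h : G, (a h ⁻¹' A).indicator (1 : Ω → ℝ≥0∞) x =
            ENNReal.ofReal (Finset.univ.filter (fun h => a h x ∈ A)).card := by
          simp [Set.indicator_apply]
        simp only [hsum, hmem]
        exact ENNReal.ofReal_le_ofReal (card_filter_card_ge_le (fun g => T (a g x)) hc)
    _ = ENNReal.ofReal c := by simp

/-- An i.i.d. sample from a product measure is invariant in law under permuting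
each coordinate separately. -/
theorem measurePreserving_coordinate_perm {ι κ : Type*} [Fintype ι] [Fintype κ]
    {𝒳 : κ → Type*} [∀ j, MeasurableSpace (𝒳 j)] (m : ∀ j, Measure (𝒳 j))
    [∀ j, IsProbabilityMeasure (m j)] (σ : κ → Equiv.Perm ι) :
    MeasurePreserving (fun (D : ι → ∀ j, 𝒳 j) i j => D (σ j i) j)
      (Measure.pi fun _ => Measure.pi m) (Measure.pi fun _ => Measure.pi m) := by
  have hmeas : Measurable (fun (D : ι → ∀ j, 𝒳 j) i j => D (σ j i) j) := by fun_prop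
  refine ⟨hmeas, ?_⟩
  let C : Set (Set (∀ j, 𝒳 j)) := Set.pi Set.univ '' Set.pi Set.univ fun j => {s | MeasurableSet s}
  have hspan : (Measure.pi m).FiniteSpanningSetsIn C :=
    { set := fun _ => Set.univ
      set_mem := fun _ => ⟨fun _ => Set.univ, by simp, by simp⟩
      finite := fun _ => by simp
      spanning := by simp [Set.iUnion_const] }
  refine (Measure.pi_eq_generateFrom (C := fun _ => C) (fun _ => generateFrom_pi)
    (fun _ => isPiSystem_pi) (fun _ => hspan) fun s hs => ?_).symm
  choose t ht hts using hs
  have hts' : s = fun i => Set.pi Set.univ (t i) := funext fun i => (hts i).symm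
  have htm : ∀ i j, MeasurableSet (t i j) := fun i j => ht i j (Set.mem_univ j)
  subst hts'
  have hpre : (fun (D : ι → ∀ j, 𝒳 j) i j => D (σ j i) j) ⁻¹'
      Set.pi Set.univ (fun i => Set.pi Set.univ (t i)) =
      Set.pi Set.univ (fun i => Set.pi Set.univ fun j => t ((σ j).symm i) j) := by
    ext D
    simp only [Set.mem_preimage, Set.mem_pi, Set.mem_univ, true_imp_iff]
    exact ⟨fun h i j => by simpa using h ((σ j).symm i) j,
      fun h i j => by simpa using h (σ j i) j⟩
  rw [Measure.map_apply hmeas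
    (MeasurableSet.univ_pi fun i => MeasurableSet.univ_pi (htm i)), hpre]
  simp only [Measure.pi_pi]
  rw [Finset.prod_comm, Finset.prod_comm (s := Finset.univ (α := ι))]
  exact Finset.prod_congr rfl fun j _ => Equiv.prod_comp (σ j).symm fun i => m j (t i j)

theorem permAct_permAct {d n : ℕ} {𝒳 : Fin d → Type*}
    (ψ φ : Fin (d-1) → Equiv.Perm (Fin n)) (D : Fin n → ∀ j, 𝒳 j) :
    permAct ψ (permAct φ D) = permAct (φ * ψ) D := by
  funext i j
  by_cases h : j.val = 0 <;> simp [permAct, h]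

theorem measurePreserving_permAct {d n : ℕ} {𝒳 : Fin d → Type*} [∀ j, MeasurableSpace (𝒳 j)]
    (m : ∀ j, Measure (𝒳 j)) [∀ j, IsProbabilityMeasure (m j)]
    (ψ : Fin (d-1) → Equiv.Perm (Fin n)) :
    MeasurePreserving (permAct (𝒳 := 𝒳) ψ)
      (Measure.pi fun _ => Measure.pi m) (Measure.pi fun _ => Measure.pi m) := by
  convert measurePreserving_coordinate_perm (ι := Fin n) m (fun j =>
    if h : j.val = 0 then 1 else ψ ⟨j.val - 1, by have := j.isLt; omega⟩) using 1
  funext D i j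
  by_cases h : j.val = 0 <;> simp [permAct, h]

/-- **Correct type 1 error rate of the permutation test enumerating all permutations.**
If the law `μ` of each observation is the product of its `d` marginals (the null
hypothesis), `T` is any measurable statistic, and
`p_D = (n!)^{-(d-1)} ⬝ #{ψ : T (ψ D) ≥ T D}` is the all-permutations `p`-value
(the identity vector is included in the count), then for every `α ∈ [0,1]` the
probability (over an i.i.d. sample `D` of size `n` from `μ`) that `p_D ≤ α`
is at most `α`. -/
theorem type1_error_all_permutations
    {d n : ℕ} (hd : 2 ≤ d) (hn : 1 ≤ n)
    (𝒳 : Fin d → Type*) [∀ j, MeasurableSpace (𝒳 j)]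
    (μ : Measure (∀ j, 𝒳 j)) [IsProbabilityMeasure μ]
    (hnull : μ = Measure.pi (fun j => μ.map (fun x => x j)))
    (T : (Fin n → ∀ j, 𝒳 j) → ℝ) (hT : Measurable T)
    (α : ℝ) (hα : α ∈ Set.Icc (0:ℝ) 1) :
    (Measure.pi fun _ : Fin n => μ)
      {D | (((Finset.univ.filter
            (fun ψ : Fin (d-1) → Equiv.Perm (Fin n) => T (permAct ψ D) ≥ T D)).card : ℝ)
          / ((n.factorial : ℝ) ^ (d-1)) ≤ α)}
      ≤ ENNReal.ofReal α := by
  have hprob : ∀ j, IsProbabilityMeasure (μ.map (fun x => x j)) := fun j =>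
    Measure.isProbabilityMeasure_map (measurable_pi_apply j).aemeasurable
  have hpres : ∀ ψ : Fin (d-1) → Equiv.Perm (Fin n), MeasurePreserving (permAct (𝒳 := 𝒳) ψ)
      (Measure.pi fun _ => μ) (Measure.pi fun _ => μ) := fun ψ => by
    have h := measurePreserving_permAct (fun j => μ.map (fun x => x j)) ψ
    rwa [← hnull] at h
  have hN : (0 : ℝ) < (n.factorial : ℝ) ^ (d-1) := by positivity
  have hcard : (Fintype.card (Fin (d-1) → Equiv.Perm (Fin n)) : ℝ≥0∞) =
      ENNReal.ofReal ((n.factorial : ℝ) ^ (d-1)) := by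
    rw [← ENNReal.ofReal_natCast]
    simp [Fintype.card_perm]
  have key := card_mul_measure_rank_le (Measure.pi fun _ : Fin n => μ) permAct
    permAct_permAct hpres T hT (mul_nonneg hα.1 hN.le)
  rw [hcard, mul_comm α, ENNReal.ofReal_mul hN.le] at key
  simp only [div_le_iff₀ hN, mul_comm α]
  exact (ENNReal.mul_le_mul_iff_right (ENNReal.ofReal_pos.2 hN).ne' ENNReal.ofReal_ne_top).1 key
end

section
/- Let (V_1, …, V_N) be an exchangeable random vector of real numbers, i.e. for every permutation σ of {1, …, N} the vector (V_{σ(1)}, …, V_{σ(N)}) has the same joint distribution as (V_1, …, V_N). Define the conservative rank of the first entry as R = 1 + #{i ∈ {2, …, N} : V_i ≥ V_1}. Then for every integer k with 1 ≤ k ≤ N, the probability that R ≤ k is at most k/N. -/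
open MeasureTheory ProbabilityTheory Filter
open scoped ENNReal Classical

/-- The number of coordinates of `x` that are at least as large as the `j`-th one, including the
`j`-th coordinate itself. -/
noncomputable def conservativeRank {ι : Type*} [Fintype ι] (x : ι → ℝ) (j : ι) : ℕ :=
  (Finset.univ.filter (fun i => x j ≤ x i)).card

lemma one_add_card_filter_ne_eq_conservativeRank {ι : Type*} [Fintype ι] [DecidableEq ι]
    (x : ι → ℝ) (j : ι) :
    1 + (Finset.univ.filter (fun i => i ≠ j ∧ x j ≤ x i)).card = conservativeRank x j := by
  have h : Finset.univ.filter (fun i => x j ≤ x i) =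
      insert j (Finset.univ.filter (fun i => i ≠ j ∧ x j ≤ x i)) := by
    ext i
    by_cases hij : i = j <;> simp [hij]
  rw [conservativeRank, h, Finset.card_insert_of_notMem (by simp), add_comm]

lemma conservativeRank_comp_perm {ι : Type*} [Fintype ι] (x : ι → ℝ) (σ : Equiv.Perm ι) (j : ι) :
    conservativeRank (fun i => x (σ i)) j = conservativeRank x (σ j) := by
  unfold conservativeRank
  exact Finset.card_equiv σ (by simp)

lemma card_conservativeRank_le {ι : Type*} [Fintype ι] (x : ι → ℝ) (k : ℕ) :
    (Finset.univ.filter (fun j => conservativeRank x j ≤ k)).card ≤ k := by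
  rcases (Finset.univ.filter (fun j => conservativeRank x j ≤ k)).eq_empty_or_nonempty with h | h
  · simp [h]
  · obtain ⟨j, hj, hmin⟩ := Finset.exists_min_image _ x h
    refine (Finset.card_le_card fun i hi => ?_).trans (Finset.mem_filter.mp hj).2
    simpa using hmin i hi

lemma measurable_conservativeRank {ι : Type*} [Fintype ι] (j : ι) :
    Measurable (fun x : ι → ℝ => conservativeRank x j) := by
  simp only [conservativeRank, Finset.card_filter]
  exact Finset.measurable_sum _ fun i _ => Measurable.ite
    (measurableSet_le (measurable_pi_apply j) (measurable_pi_apply i))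
    measurable_const measurable_const

/-- The expected number of coordinates of rank at most `k` is at most `k`. -/
lemma sum_measure_conservativeRank_le {ι : Type*} [Fintype ι] (μ : Measure (ι → ℝ))
    [IsProbabilityMeasure μ] (k : ℕ) :
    ∑ j, μ {x | conservativeRank x j ≤ k} ≤ k := by
  have hmeas (j : ι) : MeasurableSet {x : ι → ℝ | conservativeRank x j ≤ k} :=
    measurableSet_le (measurable_conservativeRank j) measurable_const
  calc ∑ j, μ {x | conservativeRank x j ≤ k}
      = ∫⁻ x, ∑ j, {x : ι → ℝ | conservativeRank x j ≤ k}.indicator 1 x ∂μ := by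
        rw [lintegral_finsetSum _ fun j _ => measurable_one.indicator (hmeas j)]
        simp only [lintegral_indicator_one (hmeas _)]
    _ ≤ ∫⁻ _, (k : ℝ≥0∞) ∂μ := by
        refine lintegral_mono fun x => ?_
        simp only [Set.indicator_apply, Set.mem_ofPred_eq, Pi.one_apply, Finset.sum_boole]
        exact_mod_cast card_conservativeRank_le x k
    _ = k := by simp

/-- **Conservative rank of the first entry of an exchangeable vector is
stochastically larger than uniform.**  Let `(V_1, …, V_N)` be an exchangeable random
vector of reals, i.e. for every permutation `σ` of the indices the permuted vector has
the same joint distribution.  If `R = 1 + #{i ≠ 1 : V_i ≥ V_1}` is the conservative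
rank of the first entry, then for every `1 ≤ k ≤ N` we have `P(R ≤ k) ≤ k/N`. -/
theorem conservative_rank_stochastically_dominates_uniform
    {Ω : Type*} [MeasurableSpace Ω] (P : Measure Ω) [IsProbabilityMeasure P]
    {N : ℕ} (hN : 0 < N)
    (V : Ω → Fin N → ℝ) (hV : Measurable V)
    (hexch : ∀ σ : Equiv.Perm (Fin N), P.map (fun ω i => V ω (σ i)) = P.map V)
    (k : ℕ) (hk1 : 1 ≤ k) (hkN : k ≤ N) :
    P {ω | 1 + (Finset.univ.filter
          (fun i : Fin N => i ≠ ⟨0, hN⟩ ∧ V ω ⟨0, hN⟩ ≤ V ω i)).card ≤ k}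
      ≤ (k : ℝ≥0∞) / (N : ℝ≥0∞) := by
  have : IsProbabilityMeasure (P.map V) := Measure.isProbabilityMeasure_map hV.aemeasurable
  have hmeas (j : Fin N) : MeasurableSet {x : Fin N → ℝ | conservativeRank x j ≤ k} :=
    measurableSet_le (measurable_conservativeRank j) measurable_const
  have hsymm (j : Fin N) : P.map V {x | conservativeRank x j ≤ k} =
      P.map V {x | conservativeRank x ⟨0, hN⟩ ≤ k} := by
    conv_rhs => rw [← hexch (Equiv.swap ⟨0, hN⟩ j)]
    rw [Measure.map_apply hV (hmeas _), Measure.map_apply (by fun_prop) (hmeas _)]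
    simp [Set.preimage, conservativeRank_comp_perm]
  have hsum := sum_measure_conservativeRank_le (P.map V) k
  simp only [hsymm, Finset.sum_const, Finset.card_univ, Fintype.card_fin, nsmul_eq_mul,
    Measure.map_apply hV (hmeas _)] at hsum
  simp only [one_add_card_filter_ne_eq_conservativeRank]
  rw [ENNReal.le_div_iff_mul_le (by simp [hN.ne']) (by simp), mul_comm]
  exact hsum
end

section
/- Assume each kernel k^j is positive semidefinite and Assumption 1 holds. Let ψ = (ψ^1, …, ψ^{d−1}) be a vector of d−1 i.i.d. permutations drawn uniformly from S_n, independent of the i.i.d. sample D = (X_1, …, X_n) from μ (μ arbitrary). Then the permuted statistic dHSIĈ(ψD) converges to 0 in probability as n → ∞: for every ε > 0, P(dHSIĈ(ψD) ≥ ε) → 0. -/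
open MeasureTheory ProbabilityTheory Filter
open scoped ENNReal Classical

instance (n : ℕ) : MeasurableSpace (Equiv.Perm (Fin n)) := ⊤

/-- The uniform distribution on the symmetric group `S_n`. -/
noncomputable def uniformPerm (n : ℕ) : Measure (Equiv.Perm (Fin n)) :=
  (PMF.uniformOfFintype (Equiv.Perm (Fin n))).toMeasure

/-- The empirical dHSIC statistic of a dataset `(x_1, …, x_n)`, built from kernels
`k^1, …, k^d`. -/
noncomputable def dHSIC {d n : ℕ} {𝒳 : Fin d → Type*} (k : ∀ j, 𝒳 j → 𝒳 j → ℝ)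
    (x : Fin n → ∀ j, 𝒳 j) : ℝ :=
  (1/(n:ℝ)^2) * ∑ i : Fin n × Fin n, ∏ j, k j (x i.1 j) (x i.2 j)
  + (1/(n:ℝ)^(2*d)) * ∑ i : Fin (2*d) → Fin n, ∏ j : Fin d,
      k j (x (i ⟨2*j.val, by have := j.isLt; omega⟩) j)
          (x (i ⟨2*j.val+1, by have := j.isLt; omega⟩) j)
  - (2/(n:ℝ)^(d+1)) * ∑ i : Fin (d+1) → Fin n, ∏ j : Fin d,
      k j (x (i 0) j) (x (i j.succ) j)

/-- A kernel is positive semidefinite if it is symmetric and all its Gram matrices are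
positive semidefinite. -/
def IsPSDKernel {α : Type*} (k : α → α → ℝ) : Prop :=
  (∀ x y, k x y = k y x) ∧
    ∀ (m : ℕ) (x : Fin m → α) (c : Fin m → ℝ),
      0 ≤ ∑ a : Fin m, ∑ b : Fin m, c a * c b * k (x a) (x b)

/-- Assumption 1: there is a uniform bound `C` on `E |∏_j k^j(Y_{τ(2j-1)}, Y_{τ(2j)})|`
over all index maps `τ`, where `Y_1, …, Y_{2d}` are i.i.d. with law `μ`. -/
def Assumption1 {d : ℕ} {𝒳 : Fin d → Type*} [∀ j, MeasurableSpace (𝒳 j)]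
    (k : ∀ j, 𝒳 j → 𝒳 j → ℝ) (μ : Measure (∀ j, 𝒳 j)) : Prop :=
  ∃ C : ℝ, ∀ τ : Fin (2*d) → Fin (2*d),
    ∫⁻ Y in Set.univ, ENNReal.ofReal |∏ j : Fin d,
        k j (Y (τ ⟨2*j.val, by have := j.isLt; omega⟩) j)
            (Y (τ ⟨2*j.val+1, by have := j.isLt; omega⟩) j)|
      ∂(Measure.pi fun _ : Fin (2*d) => μ) ≤ ENNReal.ofReal C

section Deterministic

variable {d n : ℕ} {𝒳 : Fin d → Type*}

/-- The product `∏ j, k^j(x^j_{s(j)}, x^j_{s'(j)})`, where the two index tuples `s` and `s'` are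
bundled into one function on `Fin d ⊕ Fin d`. -/
noncomputable def kernelProd (k : ∀ j, 𝒳 j → 𝒳 j → ℝ) (x : Fin n → ∀ j, 𝒳 j)
    (s : Fin d ⊕ Fin d → Fin n) : ℝ :=
  ∏ j, k j (x (s (.inl j)) j) (x (s (.inr j)) j)

/-- The average of `kernelProd` over a finite family of index tuples. -/
noncomputable def kernelProdMean {I : Type*} [Fintype I] (k : ∀ j, 𝒳 j → 𝒳 j → ℝ)
    (x : Fin n → ∀ j, 𝒳 j) (s : I → Fin d ⊕ Fin d → Fin n) : ℝ :=
  (∑ i, kernelProd k x (s i)) / Fintype.card I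

/-- Index tuples of the joint term of dHSIC. -/
def jointIndex (p : Fin n × Fin n) : Fin d ⊕ Fin d → Fin n :=
  Sum.elim (fun _ => p.1) (fun _ => p.2)

/-- Index tuples of the product-of-marginals term of dHSIC. -/
def marginalIndex (p : (Fin d → Fin n) × (Fin d → Fin n)) : Fin d ⊕ Fin d → Fin n :=
  Sum.elim p.1 p.2

/-- Index tuples of the cross term of dHSIC. -/
def crossIndex (p : Fin n × (Fin d → Fin n)) : Fin d ⊕ Fin d → Fin n :=
  Sum.elim (fun _ => p.1) p.2

/-- The enumeration of `Fin (2 * d)` by even and odd positions. -/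
noncomputable def evenOddEquiv (d : ℕ) : Fin d ⊕ Fin d ≃ Fin (2 * d) :=
  Equiv.ofBijective
    (Sum.elim (fun j => ⟨2 * j.val, by have := j.isLt; omega⟩)
      (fun j => ⟨2 * j.val + 1, by have := j.isLt; omega⟩)) <| by
    rw [Fintype.bijective_iff_injective_and_card]
    refine ⟨?_, by simp; omega⟩
    rintro (i | i) (j | j) h <;> simp [Fin.ext_iff] at h ⊢ <;> omega

theorem dHSIC_eq_kernelProdMean (k : ∀ j, 𝒳 j → 𝒳 j → ℝ) (x : Fin n → ∀ j, 𝒳 j) :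
    dHSIC k x = kernelProdMean k x jointIndex + kernelProdMean k x marginalIndex
      - 2 * kernelProdMean k x crossIndex := by
  have h2 : ∑ i : Fin (2*d) → Fin n, ∏ j : Fin d,
      k j (x (i ⟨2*j.val, by have := j.isLt; omega⟩) j)
          (x (i ⟨2*j.val+1, by have := j.isLt; omega⟩) j)
      = ∑ p, kernelProd k x (marginalIndex p) := by
    refine (Fintype.sum_equiv (((evenOddEquiv d).arrowCongr (Equiv.refl _)).symm.trans
      (Equiv.sumArrowEquivProdArrow _ _ _)) _ _ fun i => rfl)
  have h3 : ∑ i : Fin (d+1) → Fin n, ∏ j : Fin d, k j (x (i 0) j) (x (i j.succ) j)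
      = ∑ p, kernelProd k x (crossIndex p) := by
    refine (Fintype.sum_equiv (Fin.consEquiv fun _ => Fin n).symm _ _ fun i => rfl)
  rw [dHSIC, h2, h3]
  simp only [kernelProdMean, kernelProd, jointIndex, Fintype.card_prod, Fintype.card_fin,
    Fintype.card_pi, Finset.prod_const, Finset.card_univ, Nat.cast_mul, Nat.cast_pow, Sum.elim_inl,
    Sum.elim_inr]
  ring

open scoped MatrixOrder in
theorem IsPSDKernel.exists_gram {α : Type*} {k : α → α → ℝ} (hk : IsPSDKernel k) (x : Fin n → α) :
    ∃ B : Fin n → Fin n → ℝ, ∀ a b, k (x a) (x b) = ∑ r, B r a * B r b := by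
  have hM : (Matrix.of fun a b => k (x a) (x b)).PosSemidef := by
    refine Matrix.PosSemidef.of_dotProduct_mulVec_nonneg ?_ fun c => ?_
    · ext a b
      simp [hk.1 (x b) (x a)]
    · refine (hk.2 n x c).trans_eq ?_
      simp only [dotProduct, Matrix.mulVec, Finset.mul_sum, Pi.star_apply, star_trivial,
        Matrix.of_apply]
      exact Finset.sum_congr rfl fun a _ => Finset.sum_congr rfl fun b _ => by ring
  obtain ⟨B, hB⟩ := CStarAlgebra.nonneg_iff_eq_star_mul_self.mp hM.nonneg
  refine ⟨B, fun a b => ?_⟩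
  have := congrFun (congrFun hB a) b
  simpa [Matrix.mul_apply, Matrix.star_apply] using this

theorem dHSIC_nonneg {k : ∀ j, 𝒳 j → 𝒳 j → ℝ} (hk : ∀ j, IsPSDKernel (k j))
    (x : Fin n → ∀ j, 𝒳 j) : 0 ≤ dHSIC k x := by
  choose B hB using fun j => (hk j).exists_gram fun i => x i j
  have key (s : Fin d ⊕ Fin d → Fin n) : kernelProd k x s =
      ∑ r : Fin d → Fin n, (∏ j, B j (r j) (s (.inl j))) * ∏ j, B j (r j) (s (.inr j)) := by
    simp only [kernelProd, hB, Finset.prod_univ_sum, Fintype.piFinset_univ,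
      Finset.prod_mul_distrib]
  suffices h : dHSIC k x = ∑ r : Fin d → Fin n,
      ((∑ i, ∏ j, B j (r j) i) / n - (∑ t : Fin d → Fin n, ∏ j, B j (r j) (t j)) / n ^ d) ^ 2 by
    rw [h]
    positivity
  have mean {A A' : Type _} [Fintype A] [Fintype A'] (a : A → Fin d → Fin n)
      (b : A' → Fin d → Fin n) :
      kernelProdMean k x (fun p : A × A' => Sum.elim (a p.1) (b p.2)) =
        ∑ r : Fin d → Fin n, ((∑ i, ∏ j, B j (r j) (a i j)) / Fintype.card A) *
          ((∑ i, ∏ j, B j (r j) (b i j)) / Fintype.card A') := by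
    simp only [kernelProdMean, key, Sum.elim_inl, Sum.elim_inr, Fintype.card_prod]
    rw [Finset.sum_comm, Finset.sum_div]
    refine Finset.sum_congr rfl fun r _ => ?_
    rw [div_mul_div_comm, Fintype.sum_mul_sum, Fintype.sum_prod_type, Nat.cast_mul]
  have h1 := mean (fun (i : Fin n) _ => i) (fun (i : Fin n) _ => i)
  have h2 := mean (fun t : Fin d → Fin n => t) (fun t : Fin d → Fin n => t)
  have h3 := mean (fun (i : Fin n) _ => i) (fun t : Fin d → Fin n => t)
  rw [dHSIC_eq_kernelProdMean]
  unfold jointIndex marginalIndex crossIndex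
  rw [h1, h2, h3, Finset.mul_sum, ← Finset.sum_add_distrib, ← Finset.sum_sub_distrib]
  refine Finset.sum_congr rfl fun r _ => ?_
  simp only [Fintype.card_fin, Fintype.card_pi, Finset.prod_const, Finset.card_univ, Nat.cast_pow]
  ring

/-- The permutation acting on coordinate `j`: the identity for `j = 0`, and `ψ^j` otherwise. -/
def coordPerm (ψ : Fin (d-1) → Equiv.Perm (Fin n)) (j : Fin d) : Equiv.Perm (Fin n) :=
  if h : j.val = 0 then 1 else ψ ⟨j.val - 1, by have := j.isLt; omega⟩

/-- The index tuples obtained by applying a permutation vector coordinatewise. -/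
def permIndex (ψ : Fin (d-1) → Equiv.Perm (Fin n)) (s : Fin d ⊕ Fin d → Fin n) :
    Fin d ⊕ Fin d → Fin n :=
  fun u => coordPerm ψ (u.elim id id) (s u)

theorem kernelProd_permAct (k : ∀ j, 𝒳 j → 𝒳 j → ℝ) (x : Fin n → ∀ j, 𝒳 j)
    (ψ : Fin (d-1) → Equiv.Perm (Fin n)) (s : Fin d ⊕ Fin d → Fin n) :
    kernelProd k (permAct ψ x) s = kernelProd k x (permIndex ψ s) := by
  refine Finset.prod_congr rfl fun j _ => ?_
  by_cases h : j.val = 0 <;> simp [permAct, permIndex, coordPerm, h]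

end Deterministic

section Collisions

variable {d n : ℕ}

/-- If a family of injections shifts the value of `h`, then the zero fibre of `h` is no larger than
average. -/
theorem mul_card_fiber_zero_le [NeZero n] {Ω : Type*} [Fintype Ω] (h : Ω → Fin n)
    (T : Fin n → Ω → Ω) (hT : ∀ c, Function.Injective (T c))
    (hh : ∀ c ω, h ω = 0 → h (T c ω) = c) :
    n * Fintype.card {ω // h ω = 0} ≤ Fintype.card Ω := by
  have hc (c : Fin n) : Fintype.card {ω // h ω = 0} ≤ Fintype.card {ω // h ω = c} :=
    Fintype.card_le_of_injective (fun ω => ⟨T c ω, hh c ω ω.2⟩) fun a b hab =>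
      Subtype.ext (hT c (congrArg Subtype.val hab))
  calc n * Fintype.card {ω // h ω = 0} = ∑ _c : Fin n, Fintype.card {ω // h ω = 0} := by simp
    _ ≤ ∑ c : Fin n, Fintype.card {ω // h ω = c} := Finset.sum_le_sum fun c _ => hc c
    _ = Fintype.card Ω := by
      rw [← Fintype.card_sigma]
      exact Fintype.card_congr (Equiv.sigmaFiberEquiv h)

theorem mul_card_permIndex_eq_le_of_coord_ne [NeZero n] {I : Type*} [Fintype I]
    (s : I → Fin d ⊕ Fin d → Fin n) {u v : Fin d ⊕ Fin d}
    (huv : u.elim id id ≠ v.elim id id) (hv : (v.elim id id).val ≠ 0) :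
    n * Fintype.card {ω : (Fin (d-1) → Equiv.Perm (Fin n)) × I //
      permIndex ω.1 (s ω.2) u = permIndex ω.1 (s ω.2) v} ≤
      Fintype.card ((Fin (d-1) → Equiv.Perm (Fin n)) × I) := by
  set l : Fin (d-1) := ⟨(v.elim id id).val - 1, by have := (v.elim id id).isLt; omega⟩ with hl
  have := mul_card_fiber_zero_le
    (fun ω : (Fin (d-1) → Equiv.Perm (Fin n)) × I =>
      permIndex ω.1 (s ω.2) v - permIndex ω.1 (s ω.2) u)
    (fun c ω => (Pi.mulSingle l (Equiv.addRight c) * ω.1, ω.2))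
    (fun c a b hab => by simpa [Prod.ext_iff] using hab) ?_
  · convert this using 5
    rw [sub_eq_zero, eq_comm]
  · intro c ω h
    have hv' : permIndex (Pi.mulSingle l (Equiv.addRight c) * ω.1) (s ω.2) v
        = permIndex ω.1 (s ω.2) v + c := by
      simp [permIndex, coordPerm, hv, ← hl]
    have hu' : permIndex (Pi.mulSingle l (Equiv.addRight c) * ω.1) (s ω.2) u
        = permIndex ω.1 (s ω.2) u := by
      by_cases h0 : (u.elim id id).val = 0
      · simp [permIndex, coordPerm, h0]
      · have hne : (⟨(u.elim id id).val - 1, by have := (u.elim id id).isLt; omega⟩ : Fin (d-1))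
            ≠ l := by
          rw [hl, Ne, Fin.ext_iff]
          intro h'
          exact huv (Fin.ext (by simp only at h'; omega))
        simp [permIndex, coordPerm, h0, Pi.mulSingle_eq_of_ne hne]
    simp only [hv', hu']
    rw [sub_eq_zero] at h
    rw [h]
    simp

theorem mul_card_permIndex_eq_le [NeZero n] {I : Type*} [Fintype I]
    (s : I → Fin d ⊕ Fin d → Fin n)
    (hs : ∀ j, n * Fintype.card {i // s i (.inl j) = s i (.inr j)} ≤ Fintype.card I)
    {u v : Fin d ⊕ Fin d} (huv : u ≠ v) :
    n * Fintype.card {ω : (Fin (d-1) → Equiv.Perm (Fin n)) × I //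
      permIndex ω.1 (s ω.2) u = permIndex ω.1 (s ω.2) v} ≤
      Fintype.card ((Fin (d-1) → Equiv.Perm (Fin n)) × I) := by
  by_cases hc : u.elim id id = v.elim id id
  · have same (j : Fin d) : n * Fintype.card {ω : (Fin (d-1) → Equiv.Perm (Fin n)) × I //
        s ω.2 (.inl j) = s ω.2 (.inr j)} ≤
        Fintype.card ((Fin (d-1) → Equiv.Perm (Fin n)) × I) := by
      rw [Fintype.card_congr (Equiv.subtypeProdEquivSigmaSubtype
        fun _ i => s i (.inl j) = s i (.inr j)), Fintype.card_sigma, Finset.sum_const,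
        Finset.card_univ, smul_eq_mul, Fintype.card_prod, mul_left_comm]
      exact Nat.mul_le_mul_left _ (hs j)
    rcases u with i | i <;> rcases v with j | j <;> simp only [Sum.elim_inl, Sum.elim_inr, id] at hc
      <;> subst hc
    · exact absurd rfl huv
    · simpa [permIndex] using same i
    · simpa [permIndex, eq_comm] using same i
    · exact absurd rfl huv
  · by_cases hv : (v.elim id id).val = 0
    · have hu : (u.elim id id).val ≠ 0 := fun h => hc (Fin.ext (h.trans hv.symm))
      simpa only [eq_comm] using mul_card_permIndex_eq_le_of_coord_ne s (Ne.symm hc) hu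
    · exact mul_card_permIndex_eq_le_of_coord_ne s hc hv

theorem mul_card_not_injective_permIndex_le [NeZero n] {I : Type*} [Fintype I]
    (s : I → Fin d ⊕ Fin d → Fin n)
    (hs : ∀ j, n * Fintype.card {i // s i (.inl j) = s i (.inr j)} ≤ Fintype.card I) :
    n * Fintype.card {ω : (Fin (d-1) → Equiv.Perm (Fin n)) × I //
      ¬ Function.Injective (permIndex ω.1 (s ω.2))} ≤
      (2 * d) ^ 2 * Fintype.card ((Fin (d-1) → Equiv.Perm (Fin n)) × I) := by
  set Ω := (Fin (d-1) → Equiv.Perm (Fin n)) × I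
  set P := {p : (Fin d ⊕ Fin d) × (Fin d ⊕ Fin d) // p.1 ≠ p.2}
  have hcard : Fintype.card P ≤ (2 * d) ^ 2 := by
    refine (Fintype.card_subtype_le _).trans_eq ?_
    simp [two_mul, sq]
  have hle : Fintype.card {ω : Ω // ¬ Function.Injective (permIndex ω.1 (s ω.2))} ≤
      ∑ p : P, Fintype.card {ω : Ω //
        permIndex ω.1 (s ω.2) p.1.1 = permIndex ω.1 (s ω.2) p.1.2} := by
    rw [← Fintype.card_sigma]
    refine Fintype.card_le_of_surjective (α := Σ p : P, _)
      (fun z => ⟨z.2.1, fun h => z.1.2 (h z.2.2)⟩) ?_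
    rintro ⟨ω, hω⟩
    simp only [Function.Injective, not_forall] at hω
    obtain ⟨a, b, h, hab⟩ := hω
    exact ⟨⟨⟨(a, b), hab⟩, ω, h⟩, rfl⟩
  calc _ ≤ n * ∑ p : P, Fintype.card {ω : Ω //
        permIndex ω.1 (s ω.2) p.1.1 = permIndex ω.1 (s ω.2) p.1.2} := Nat.mul_le_mul_left _ hle
    _ ≤ ∑ _p : P, Fintype.card Ω := by
      rw [Finset.mul_sum]
      exact Finset.sum_le_sum fun p _ => mul_card_permIndex_eq_le s hs p.2
    _ ≤ _ := by
      rw [Finset.sum_const, Finset.card_univ, smul_eq_mul]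
      exact Nat.mul_le_mul_right _ hcard

theorem mul_card_jointIndex_eq_le [NeZero n] (j : Fin d) :
    n * Fintype.card {p : Fin n × Fin n // jointIndex p (.inl j) = jointIndex p (.inr j)} ≤
      Fintype.card (Fin n × Fin n) := by
  have := mul_card_fiber_zero_le (fun p : Fin n × Fin n => p.2 - p.1)
    (fun c p => (p.1, p.2 + c)) (fun c a b h => by simpa [Prod.ext_iff] using h)
    (fun c p h => by simp only [sub_eq_zero] at h; simp [h])
  convert this using 5
  rw [sub_eq_zero, eq_comm]
  rfl

theorem mul_card_marginalIndex_eq_le [NeZero n] (j : Fin d) :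
    n * Fintype.card {p : (Fin d → Fin n) × (Fin d → Fin n) //
      marginalIndex p (.inl j) = marginalIndex p (.inr j)} ≤
      Fintype.card ((Fin d → Fin n) × (Fin d → Fin n)) := by
  have := mul_card_fiber_zero_le (fun p : (Fin d → Fin n) × (Fin d → Fin n) => p.2 j - p.1 j)
    (fun c p => (p.1, p.2 + Pi.single j c)) (fun c a b h => by simpa [Prod.ext_iff] using h)
    (fun c p h => by simp only [sub_eq_zero] at h; simp [h])
  convert this using 5
  rw [sub_eq_zero, eq_comm]
  rfl

theorem mul_card_crossIndex_eq_le [NeZero n] (j : Fin d) :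
    n * Fintype.card {p : Fin n × (Fin d → Fin n) //
      crossIndex p (.inl j) = crossIndex p (.inr j)} ≤
      Fintype.card (Fin n × (Fin d → Fin n)) := by
  have := mul_card_fiber_zero_le (fun p : Fin n × (Fin d → Fin n) => p.2 j - p.1)
    (fun c p => (p.1, p.2 + Pi.single j c)) (fun c a b h => by simpa [Prod.ext_iff] using h)
    (fun c p h => by simp only [sub_eq_zero] at h; simp [h])
  convert this using 5
  rw [sub_eq_zero, eq_comm]
  rfl

end Collisions

section Moments

variable {d n : ℕ} {𝒳 : Fin d → Type*} [∀ j, MeasurableSpace (𝒳 j)]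
  {k : ∀ j, 𝒳 j → 𝒳 j → ℝ} {μ : Measure (∀ j, 𝒳 j)} [IsProbabilityMeasure μ]

theorem measurePreserving_comp_injective {E : Type*} [MeasurableSpace E] (μ : Measure E)
    [IsProbabilityMeasure μ] {m : ℕ} {ι : Fin m → Fin n} (hι : Function.Injective ι) :
    MeasurePreserving (fun (D : Fin n → E) u => D (ι u)) (Measure.pi fun _ => μ)
      (Measure.pi fun _ => μ) := by
  refine ⟨by fun_prop, ?_⟩
  have h := (iIndepFun_pi (μ := fun _ : Fin n => μ) (X := fun _ x => x)
    fun _ => aemeasurable_id).precomp hι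
  rw [iIndepFun_iff_map_fun_eq_pi_map fun i => (measurable_pi_apply _).aemeasurable] at h
  simpa only [(measurePreserving_eval (fun _ : Fin n => μ) _).map_eq] using h

theorem measurable_kernelProd (hk : ∀ j, Measurable (fun p : 𝒳 j × 𝒳 j => k j p.1 p.2))
    (s : Fin d ⊕ Fin d → Fin n) : Measurable fun D => kernelProd k D s := by
  refine Finset.measurable_prod _ fun j _ => (hk j).comp (f := fun D : Fin n → ∀ j, 𝒳 j =>
    (D (s (.inl j)) j, D (s (.inr j)) j)) ?_
  fun_prop

theorem integral_kernelProd_of_injective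
    (hk : ∀ j, Measurable (fun p : 𝒳 j × 𝒳 j => k j p.1 p.2))
    {s : Fin d ⊕ Fin d → Fin n} (hs : Function.Injective s) :
    ∫ D, kernelProd k D s ∂(Measure.pi fun _ : Fin n => μ) =
      ∫ Y, kernelProd k Y (evenOddEquiv d) ∂(Measure.pi fun _ => μ) := by
  have h := measurePreserving_comp_injective μ (hs.comp (evenOddEquiv d).symm.injective)
  rw [← h.map_eq, integral_map h.measurable.aemeasurable
    (measurable_kernelProd hk _).aestronglyMeasurable]
  simp [kernelProd]

theorem exists_injective_factorization {m : ℕ} (hmn : m ≤ n) (σ : Fin m → Fin n) :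
    ∃ (ι : Fin m → Fin n) (τ : Fin m → Fin m), Function.Injective ι ∧ ∀ u, σ u = ι (τ u) := by
  obtain ⟨t, hst, ht⟩ := Finset.exists_superset_card_eq (s := Finset.univ.image σ) (n := m)
    (Finset.card_image_le.trans_eq (by simp)) (by simpa using hmn)
  have h (u : Fin m) : ∃ v, t.orderEmbOfFin ht v = σ u := by
    have : σ u ∈ Set.range (t.orderEmbOfFin ht) := by
      rw [Finset.range_orderEmbOfFin]
      exact hst (Finset.mem_image_of_mem _ (Finset.mem_univ _))
    exact this
  choose τ hτ using h
  exact ⟨_, τ, (t.orderEmbOfFin ht).injective, fun u => (hτ u).symm⟩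

theorem Assumption1.exists_lintegral_le (hA : Assumption1 k μ)
    (hk : ∀ j, Measurable (fun p : 𝒳 j × 𝒳 j => k j p.1 p.2)) :
    ∃ C : ℝ, 0 ≤ C ∧ ∀ n, 2 * d ≤ n → ∀ s : Fin d ⊕ Fin d → Fin n,
      ∫⁻ D, ‖kernelProd k D s‖ₑ ∂(Measure.pi fun _ : Fin n => μ) ≤ ENNReal.ofReal C := by
  obtain ⟨C, hC⟩ := hA
  refine ⟨max C 0, le_max_right _ _, fun n hn s => ?_⟩
  obtain ⟨ι, τ, hι, hτ⟩ := exists_injective_factorization hn (s ∘ (evenOddEquiv d).symm)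
  have h := measurePreserving_comp_injective μ hι
  have hs (u) : s u = ι (τ (evenOddEquiv d u)) := by rw [← hτ]; simp
  have hC' := hC τ
  rw [Measure.restrict_univ] at hC'
  calc _ = ∫⁻ D, ‖kernelProd k (fun u => D (ι u)) (fun u => τ (evenOddEquiv d u))‖ₑ
        ∂(Measure.pi fun _ : Fin n => μ) := by simp only [kernelProd, hs]
    _ = ∫⁻ Y, ‖kernelProd k Y (fun u => τ (evenOddEquiv d u))‖ₑ ∂(Measure.pi fun _ => μ) :=
      h.lintegral_comp (measurable_kernelProd hk _).enorm
    _ ≤ ENNReal.ofReal C := by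
      refine le_of_eq_of_le (lintegral_congr fun Y => ?_) hC'
      rw [Real.enorm_eq_ofReal_abs]
      rfl
    _ ≤ _ := ENNReal.ofReal_le_ofReal (le_max_left _ _)

theorem Assumption1.exists_moment_bound (hA : Assumption1 k μ)
    (hk : ∀ j, Measurable (fun p : 𝒳 j × 𝒳 j => k j p.1 p.2)) :
    ∃ C : ℝ, 0 ≤ C ∧ ∀ n, 2 * d ≤ n → ∀ s : Fin d ⊕ Fin d → Fin n,
      Integrable (fun D => kernelProd k D s) (Measure.pi fun _ : Fin n => μ) ∧
      |∫ D, kernelProd k D s ∂(Measure.pi fun _ : Fin n => μ)| ≤ C := by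
  obtain ⟨C, hC0, hC⟩ := hA.exists_lintegral_le hk
  refine ⟨C, hC0, fun n hn s => ⟨⟨(measurable_kernelProd hk s).aestronglyMeasurable,
    (hC n hn s).trans_lt ENNReal.ofReal_lt_top⟩, ?_⟩⟩
  rw [← ENNReal.ofReal_le_ofReal_iff hC0, ← Real.enorm_eq_ofReal_abs]
  exact (enorm_integral_le_lintegral_enorm _).trans (hC n hn s)

end Moments

theorem abs_average_sub_le {Ω : Type*} [Fintype Ω] [Nonempty Ω] {f : Ω → ℝ} {θ C : ℝ}
    {p : Ω → Prop} [DecidablePred p] (hp : ∀ ω, p ω → f ω = θ) (hf : ∀ ω, |f ω| ≤ C) (hθ : |θ| ≤ C)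
    {n K : ℕ} (hn : 0 < n)
    (hcard : n * Fintype.card {ω // ¬ p ω} ≤ K * Fintype.card Ω) :
    |(∑ ω, f ω) / Fintype.card Ω - θ| ≤ 2 * C * K / n := by
  have hΩ : (0 : ℝ) < Fintype.card Ω := by exact_mod_cast Fintype.card_pos
  have hn' : (0 : ℝ) < n := by exact_mod_cast hn
  have hC : 0 ≤ C := (abs_nonneg _).trans hθ
  have hsum : |∑ ω, (f ω - θ)| ≤ 2 * C * Fintype.card {ω // ¬ p ω} := by
    calc |∑ ω, (f ω - θ)| ≤ ∑ ω, |f ω - θ| := Finset.abs_sum_le_sum_abs _ _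
      _ ≤ ∑ ω, if ¬ p ω then 2 * C else 0 := by
        refine Finset.sum_le_sum fun ω _ => ?_
        by_cases h : p ω
        · simp [h, hp ω h]
        · rw [if_pos h]
          linarith [abs_sub (f ω) θ, hf ω]
      _ = _ := by
        rw [← Finset.sum_filter, Finset.sum_const, nsmul_eq_mul, Fintype.card_subtype, mul_comm]
  have heq : (∑ ω, f ω) / Fintype.card Ω - θ = (∑ ω, (f ω - θ)) / Fintype.card Ω := by
    rw [Finset.sum_sub_distrib, Finset.sum_const, Finset.card_univ, nsmul_eq_mul]
    field_simp
  have hcard' : (n : ℝ) * Fintype.card {ω // ¬ p ω} ≤ K * Fintype.card Ω := by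
    exact_mod_cast hcard
  rw [heq, abs_div, abs_of_pos hΩ, div_le_div_iff₀ hΩ hn']
  calc _ ≤ 2 * C * Fintype.card {ω // ¬ p ω} * n := by gcongr
    _ = 2 * C * (n * Fintype.card {ω // ¬ p ω}) := by ring
    _ ≤ 2 * C * (K * Fintype.card Ω) := by gcongr
    _ = _ := by ring

section PermutationAverage

variable {d n : ℕ}

instance (n : ℕ) : MeasurableSingletonClass (Equiv.Perm (Fin n)) := ⟨fun _ => trivial⟩

instance (n : ℕ) : IsProbabilityMeasure (uniformPerm n) :=
  PMF.toMeasure.isProbabilityMeasure _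

theorem pi_uniformPerm_singleton (m : ℕ) (ψ : Fin m → Equiv.Perm (Fin n)) :
    Measure.pi (fun _ : Fin m => uniformPerm n) {ψ} =
      (Fintype.card (Fin m → Equiv.Perm (Fin n)) : ℝ≥0∞)⁻¹ := by
  rw [Measure.pi_singleton]
  simp [uniformPerm, ENNReal.inv_pow]

variable {𝒳 : Fin d → Type*} [∀ j, MeasurableSpace (𝒳 j)]
  {k : ∀ j, 𝒳 j → 𝒳 j → ℝ} {μ : Measure (∀ j, 𝒳 j)}

theorem integrable_kernelProdMean_permAct {I : Type*} [Fintype I]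
    (hInt : ∀ s : Fin d ⊕ Fin d → Fin n,
      Integrable (fun D => kernelProd k D s) (Measure.pi fun _ : Fin n => μ))
    (s : I → Fin d ⊕ Fin d → Fin n) (ψ : Fin (d-1) → Equiv.Perm (Fin n)) :
    Integrable (fun D => kernelProdMean k (permAct ψ D) s) (Measure.pi fun _ : Fin n => μ) := by
  simp only [kernelProdMean, kernelProd_permAct]
  exact (integrable_finsetSum _ fun i _ => hInt _).div_const _

theorem integrable_dHSIC_permAct
    (hInt : ∀ s : Fin d ⊕ Fin d → Fin n,
      Integrable (fun D => kernelProd k D s) (Measure.pi fun _ : Fin n => μ))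
    (ψ : Fin (d-1) → Equiv.Perm (Fin n)) :
    Integrable (fun D => dHSIC k (permAct ψ D)) (Measure.pi fun _ : Fin n => μ) := by
  simp only [dHSIC_eq_kernelProdMean]
  exact ((integrable_kernelProdMean_permAct hInt _ ψ).add
    (integrable_kernelProdMean_permAct hInt _ ψ)).sub
    ((integrable_kernelProdMean_permAct hInt _ ψ).const_mul 2)

/-- The permutation average of the expectation of `kernelProdMean` is an average over all
permutation vectors and index tuples. -/
theorem average_integral_kernelProdMean_permAct {I : Type*} [Fintype I]
    (hInt : ∀ s : Fin d ⊕ Fin d → Fin n,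
      Integrable (fun D => kernelProd k D s) (Measure.pi fun _ : Fin n => μ))
    (s : I → Fin d ⊕ Fin d → Fin n) :
    (∑ ψ : Fin (d-1) → Equiv.Perm (Fin n),
      ∫ D, kernelProdMean k (permAct ψ D) s ∂(Measure.pi fun _ : Fin n => μ)) /
        Fintype.card (Fin (d-1) → Equiv.Perm (Fin n)) =
    (∑ ω : (Fin (d-1) → Equiv.Perm (Fin n)) × I,
      ∫ D, kernelProd k D (permIndex ω.1 (s ω.2)) ∂(Measure.pi fun _ : Fin n => μ)) /
        Fintype.card ((Fin (d-1) → Equiv.Perm (Fin n)) × I) := by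
  simp only [kernelProdMean, kernelProd_permAct, integral_div,
    integral_finsetSum _ fun _ _ => hInt _]
  rw [Fintype.sum_prod_type, ← Finset.sum_div, div_div, Fintype.card_prod, Nat.cast_mul, mul_comm]

variable [IsProbabilityMeasure μ]

theorem abs_average_integral_kernelProdMean_sub_le [NeZero n] {I : Type*} [Fintype I] [Nonempty I]
    (hk : ∀ j, Measurable (fun p : 𝒳 j × 𝒳 j => k j p.1 p.2)) {C : ℝ}
    (hInt : ∀ s : Fin d ⊕ Fin d → Fin n,
      Integrable (fun D => kernelProd k D s) (Measure.pi fun _ : Fin n => μ))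
    (hC : ∀ s : Fin d ⊕ Fin d → Fin n,
      |∫ D, kernelProd k D s ∂(Measure.pi fun _ : Fin n => μ)| ≤ C)
    (hθ : |∫ Y, kernelProd k Y (evenOddEquiv d) ∂(Measure.pi fun _ => μ)| ≤ C)
    (s : I → Fin d ⊕ Fin d → Fin n)
    (hs : ∀ j, n * Fintype.card {i // s i (.inl j) = s i (.inr j)} ≤ Fintype.card I) :
    |(∑ ψ : Fin (d-1) → Equiv.Perm (Fin n),
      ∫ D, kernelProdMean k (permAct ψ D) s ∂(Measure.pi fun _ : Fin n => μ)) /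
        Fintype.card (Fin (d-1) → Equiv.Perm (Fin n)) -
      ∫ Y, kernelProd k Y (evenOddEquiv d) ∂(Measure.pi fun _ => μ)| ≤
      2 * C * ((2 * d) ^ 2 : ℕ) / n := by
  rw [average_integral_kernelProdMean_permAct hInt]
  exact abs_average_sub_le (fun ω hω => integral_kernelProd_of_injective hk hω)
    (fun ω => hC _) hθ (NeZero.pos n) (mul_card_not_injective_permIndex_le s hs)

theorem average_integral_dHSIC_permAct_le [NeZero n]
    (hk : ∀ j, Measurable (fun p : 𝒳 j × 𝒳 j => k j p.1 p.2)) {C : ℝ}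
    (hInt : ∀ s : Fin d ⊕ Fin d → Fin n,
      Integrable (fun D => kernelProd k D s) (Measure.pi fun _ : Fin n => μ))
    (hC : ∀ s : Fin d ⊕ Fin d → Fin n,
      |∫ D, kernelProd k D s ∂(Measure.pi fun _ : Fin n => μ)| ≤ C)
    (hθ : |∫ Y, kernelProd k Y (evenOddEquiv d) ∂(Measure.pi fun _ => μ)| ≤ C) :
    (∑ ψ : Fin (d-1) → Equiv.Perm (Fin n),
      ∫ D, dHSIC k (permAct ψ D) ∂(Measure.pi fun _ : Fin n => μ)) /
        Fintype.card (Fin (d-1) → Equiv.Perm (Fin n)) ≤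
      4 * (2 * C * ((2 * d) ^ 2 : ℕ) / n) := by
  have h1 := abs_average_integral_kernelProdMean_sub_le hk hInt hC hθ jointIndex
    mul_card_jointIndex_eq_le
  have h2 := abs_average_integral_kernelProdMean_sub_le hk hInt hC hθ marginalIndex
    mul_card_marginalIndex_eq_le
  have h3 := abs_average_integral_kernelProdMean_sub_le hk hInt hC hθ crossIndex
    mul_card_crossIndex_eq_le
  have hsplit (ψ : Fin (d-1) → Equiv.Perm (Fin n)) :
      ∫ D, dHSIC k (permAct ψ D) ∂(Measure.pi fun _ : Fin n => μ) =
      ∫ D, kernelProdMean k (permAct ψ D) jointIndex ∂(Measure.pi fun _ : Fin n => μ) +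
      ∫ D, kernelProdMean k (permAct ψ D) marginalIndex ∂(Measure.pi fun _ : Fin n => μ) -
      2 * ∫ D, kernelProdMean k (permAct ψ D) crossIndex ∂(Measure.pi fun _ : Fin n => μ) := by
    simp only [dHSIC_eq_kernelProdMean]
    rw [integral_sub ((integrable_kernelProdMean_permAct hInt _ ψ).fun_add
      (integrable_kernelProdMean_permAct hInt _ ψ))
      ((integrable_kernelProdMean_permAct hInt _ ψ).const_mul 2),
      integral_add (integrable_kernelProdMean_permAct hInt _ ψ)
      (integrable_kernelProdMean_permAct hInt _ ψ), integral_const_mul]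
  simp only [hsplit, Finset.sum_sub_distrib, Finset.sum_add_distrib, ← Finset.mul_sum, sub_div,
    add_div, mul_div_assoc] at h1 h2 h3 ⊢
  rw [abs_le] at h1 h2 h3
  linarith [h1.2, h2.2, h3.1]

/-- A probability over the sample and the permutations is the permutation average of probabilities
over the sample. -/
theorem prod_pi_uniformPerm_real_apply {E : Type*} [MeasurableSpace E] {m : ℕ} (ν : Measure E)
    [IsProbabilityMeasure ν] {A : Set (E × (Fin m → Equiv.Perm (Fin n)))} (hA : MeasurableSet A) :
    (ν.prod (Measure.pi fun _ : Fin m => uniformPerm n)).real A =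
      (∑ ψ, ν.real {D | (D, ψ) ∈ A}) / Fintype.card (Fin m → Equiv.Perm (Fin n)) := by
  rw [measureReal_def, Measure.prod_apply_symm hA, lintegral_fintype,
    ENNReal.toReal_sum fun ψ _ => ENNReal.mul_ne_top (measure_ne_top _ _) (measure_ne_top _ _),
    Finset.sum_div]
  refine Finset.sum_congr rfl fun ψ _ => ?_
  rw [pi_uniformPerm_singleton, ENNReal.toReal_mul, ENNReal.toReal_inv, ENNReal.toReal_natCast,
    div_eq_mul_inv]
  rfl

end PermutationAverage

/-- **The dHSIC statistic of a randomly permuted sample converges to zero in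
probability.**  Assume each kernel `k^j` is positive semidefinite and Assumption 1
holds.  Let `ψ = (ψ^1, …, ψ^{d-1})` be a vector of `d-1` i.i.d. uniform permutations,
independent of the i.i.d. sample `D` of size `n` from `μ` (with `μ` arbitrary).  Then
for every `ε > 0`, `P(dHSIĈ(ψ D) ≥ ε) → 0` as `n → ∞`. -/
theorem permuted_dHSIC_tendsto_zero_in_probability
    {d : ℕ} (hd : 2 ≤ d)
    (𝒳 : Fin d → Type*) [∀ j, MeasurableSpace (𝒳 j)]
    (k : ∀ j, 𝒳 j → 𝒳 j → ℝ)
    (hk : ∀ j, Measurable (fun p : 𝒳 j × 𝒳 j => k j p.1 p.2))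
    (hpsd : ∀ j, IsPSDKernel (k j))
    (μ : Measure (∀ j, 𝒳 j)) [IsProbabilityMeasure μ]
    (hA1 : Assumption1 k μ)
    (ε : ℝ) (hε : 0 < ε) :
    Tendsto (fun n : ℕ =>
        ((Measure.pi fun _ : Fin n => μ).prod
            (Measure.pi fun _ : Fin (d-1) => uniformPerm n))
          {ω | ε ≤ dHSIC k (permAct ω.2 ω.1)})
      atTop (nhds 0) := by
  obtain ⟨C, hC0, hC⟩ := hA1.exists_moment_bound hk
  have hbound (n : ℕ) (hn : 2 * d ≤ n) :
      ((Measure.pi fun _ : Fin n => μ).prod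
        (Measure.pi fun _ : Fin (d-1) => uniformPerm n)).real
          {ω | ε ≤ dHSIC k (permAct ω.2 ω.1)} ≤ 8 * C * ((2 * d) ^ 2 : ℕ) / ε / n := by
    have : NeZero n := ⟨by omega⟩
    have hInt (s) := (hC n hn s).1
    have hmeas : Measurable fun ω : (Fin n → ∀ j, 𝒳 j) × (Fin (d-1) → Equiv.Perm (Fin n)) =>
        dHSIC k (permAct ω.2 ω.1) := by
      refine measurable_from_prod_countable_left fun ψ => ?_
      simp only [dHSIC_eq_kernelProdMean, kernelProdMean, kernelProd_permAct]
      have := fun s => measurable_kernelProd (n := n) hk s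
      fun_prop
    rw [prod_pi_uniformPerm_real_apply _ (measurableSet_le measurable_const hmeas), div_div,
      mul_comm ε, ← div_div, le_div_iff₀' hε, ← mul_div_assoc, Finset.mul_sum]
    calc _ ≤ (∑ ψ : Fin (d-1) → Equiv.Perm (Fin n),
          ∫ D, dHSIC k (permAct ψ D) ∂(Measure.pi fun _ : Fin n => μ)) /
            Fintype.card (Fin (d-1) → Equiv.Perm (Fin n)) := by
          gcongr with ψ
          exact mul_meas_ge_le_integral_of_nonneg (ae_of_all _ fun D => dHSIC_nonneg hpsd _)
            (integrable_dHSIC_permAct hInt ψ) ε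
      _ ≤ 4 * (2 * C * ((2 * d) ^ 2 : ℕ) / n) :=
          average_integral_dHSIC_permAct_le hk hInt (fun s => (hC n hn s).2)
            (hC (2 * d) le_rfl _).2
      _ = _ := by ring
  rw [← ENNReal.tendsto_toReal_iff (fun n => measure_ne_top _ _) ENNReal.zero_ne_top]
  refine tendsto_of_tendsto_of_tendsto_of_le_of_le' tendsto_const_nhds
    (tendsto_const_div_atTop_nhds_zero_nat (8 * C * ((2 * d) ^ 2 : ℕ) / ε))
    (Eventually.of_forall fun n => ENNReal.toReal_nonneg) ?_
  filter_upwards [eventually_ge_atTop (2 * d)] with n hn using hbound n hn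
end

section
/- For each n, let N_n be a positive integer with N_n → ∞, let (Y_{n,1}, …, Y_{n,N_n}) be nonnegative random variables on a common probability space, and let J_n be uniformly distributed on {1, …, N_n}, independent of (Y_{n,1}, …, Y_{n,N_n}). Assume that Y_{n,J_n} → 0 in probability, i.e. P(Y_{n,J_n} ≥ ε) → 0 for every ε > 0. Fix α ∈ (0,1) and let t_n^a denote the a-th largest value among Y_{n,1}, …, Y_{n,N_n} (counted with multiplicity), where a = ⌊α N_n⌋. Then t_n^a → 0 in probability as n → ∞. -/
open MeasureTheory ProbabilityTheory Filter
open scoped ENNReal Classical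

instance (m : ℕ) : MeasurableSpace (Fin m) := ⊤

/-- The `a`-th largest value (counted with multiplicity) of a finite family of reals
indexed by a fintype `ι`; it is the `(card ι - a)`-th entry (0-indexed) of the family
sorted in increasing order. -/
noncomputable def kthLargest {ι : Type*} [Fintype ι] (f : ι → ℝ) (a : ℕ) : ℝ :=
  ((Finset.univ.val.map f).sort (· ≤ ·)).getD (Fintype.card ι - a) 0

/-- If the `a`-th largest value of a finite family is at least `ε > 0`, then at least `a` members
of the family are at least `ε`. -/
theorem le_card_filter_of_le_kthLargest {ι : Type*} [Fintype ι] {f : ι → ℝ} {a : ℕ} {ε : ℝ}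
    (ha : a ≤ Fintype.card ι) (hε : 0 < ε) (h : ε ≤ kthLargest f a) :
    a ≤ (Finset.univ.filter fun i => ε ≤ f i).card := by
  set l := (Finset.univ.val.map f).sort (· ≤ ·) with hl
  have hlen : l.length = Fintype.card ι := by simp [hl]
  have hsorted : l.Pairwise (· ≤ ·) := Multiset.pairwise_sort _ _
  have hcount : l.countP (fun x => ε ≤ x) = (Finset.univ.filter fun i => ε ≤ f i).card := by
    rw [← Multiset.coe_countP, hl, Multiset.sort_eq, Multiset.countP_map]
    rfl
  have hk : Fintype.card ι - a < l.length := by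
    by_contra hk
    rw [kthLargest, ← hl, List.getD_eq_default _ _ (not_lt.mp hk)] at h
    exact absurd h (not_le.mpr hε)
  rw [kthLargest, ← hl, List.getD_eq_getElem _ _ hk] at h
  have hdrop : (l.drop (Fintype.card ι - a)).countP (fun x => ε ≤ x) =
      (l.drop (Fintype.card ι - a)).length := by
    rw [List.countP_eq_length]
    have hs := hsorted.drop (i := Fintype.card ι - a)
    rw [List.drop_eq_getElem_cons hk] at hs ⊢
    intro x hx
    rcases List.mem_cons.mp hx with rfl | hx
    · simpa using h
    · simpa using h.trans ((List.pairwise_cons.mp hs).1 x hx)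
  calc a = (l.drop (Fintype.card ι - a)).length := by rw [List.length_drop]; omega
    _ = (l.drop (Fintype.card ι - a)).countP (fun x => ε ≤ x) := hdrop.symm
    _ ≤ l.countP (fun x => ε ≤ x) := (List.drop_sublist _ _).countP_le
    _ = _ := hcount

/-- Markov's inequality for the number of entries of a random vector that are at least `ε`:
it bounds the tail of the `a`-th largest entry by that of a uniformly chosen entry. -/
theorem mul_measure_le_kthLargest_le {Ω : Type*} [MeasurableSpace Ω] (P : Measure Ω) [SFinite P]
    {m : ℕ} {Y : Ω → Fin m → ℝ} (hY : Measurable Y) {a : ℕ} (ha : a ≤ m) {ε : ℝ} (hε : 0 < ε) :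
    (m : ℝ≥0∞)⁻¹ * a * P {ω | ε ≤ kthLargest (Y ω) a} ≤
      (P.prod ((m : ℝ≥0∞)⁻¹ • Measure.count)) {ω : Ω × Fin m | ε ≤ Y ω.1 ω.2} := by
  have hmeas : MeasurableSet {ω : Ω × Fin m | ε ≤ Y ω.1 ω.2} := by
    refine measurableSet_le measurable_const (measurable_from_prod_countable_left fun i => ?_)
    exact (measurable_pi_apply i).comp hY
  rw [Measure.prod_apply hmeas]
  refine le_trans ?_ (mul_meas_ge_le_lintegral (measurable_measure_prodMk_left hmeas)
    ((m : ℝ≥0∞)⁻¹ * a))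
  gcongr with ω
  intro hω
  have hcard := le_card_filter_of_le_kthLargest (by simpa using ha) hε hω
  have hset : Prod.mk ω ⁻¹' {ω : Ω × Fin m | ε ≤ Y ω.1 ω.2} =
      ((Finset.univ.filter fun i => ε ≤ Y ω i : Finset (Fin m)) : Set (Fin m)) := by
    ext i; simp
  rw [hset, Measure.smul_apply, Measure.count_apply_finset, smul_eq_mul]
  gcongr

/-- **If a uniformly chosen entry of a nonnegative triangular array tends to zero in
probability, then so does the `⌊α N_n⌋`-th largest entry.**  For each `n`, let `N_n` be
a positive integer with `N_n → ∞`, let `(Y_{n,1}, …, Y_{n,N_n})` be nonnegative random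
variables and `J_n` uniform on `{1, …, N_n}` independent of them (modelled on the
product of the underlying probability space with the normalised counting measure).
If `P(Y_{n,J_n} ≥ ε) → 0` for every `ε > 0`, then for fixed `α ∈ (0,1)` the
`a`-th largest value `t_n^a` among `Y_{n,1}, …, Y_{n,N_n}`, with `a = ⌊α N_n⌋`,
tends to zero in probability. -/
theorem kth_largest_tendsto_zero_of_uniform_entry_tendsto_zero
    {Ω : ℕ → Type*} [∀ n, MeasurableSpace (Ω n)]
    (P : ∀ n, Measure (Ω n)) [∀ n, IsProbabilityMeasure (P n)]
    (N : ℕ → ℕ) (hNpos : ∀ n, 0 < N n) (hN : Tendsto N atTop atTop)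
    (Y : ∀ n, Ω n → Fin (N n) → ℝ)
    (hYmeas : ∀ n, Measurable (Y n))
    (hYnonneg : ∀ n ω i, 0 ≤ Y n ω i)
    (hYJ : ∀ ε : ℝ, 0 < ε →
      Tendsto (fun n : ℕ =>
          ((P n).prod ((N n : ℝ≥0∞)⁻¹ • Measure.count))
            {ω : Ω n × Fin (N n) | ε ≤ Y n ω.1 ω.2})
        atTop (nhds 0))
    (α : ℝ) (hα : α ∈ Set.Ioo (0:ℝ) 1)
    (ε : ℝ) (hε : 0 < ε) :
    Tendsto (fun n : ℕ =>
        (P n) {ω | ε ≤ kthLargest (Y n ω) (⌊α * (N n : ℝ)⌋₊)})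
      atTop (nhds 0) := by
  have hα0 : 0 < α := hα.1
  have hlim : Tendsto (fun n : ℕ => ENNReal.ofReal (2 / α) *
      ((P n).prod ((N n : ℝ≥0∞)⁻¹ • Measure.count))
        {ω : Ω n × Fin (N n) | ε ≤ Y n ω.1 ω.2}) atTop (nhds 0) := by
    simpa using ENNReal.Tendsto.const_mul (hYJ ε hε) (Or.inr ENNReal.ofReal_ne_top)
  refine tendsto_of_tendsto_of_tendsto_of_le_of_le' tendsto_const_nhds hlim
    (Eventually.of_forall fun _ => zero_le) ?_
  filter_upwards [(tendsto_natCast_atTop_atTop (R := ℝ)).comp hN |>.eventually_ge_atTop (2 / α)]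
    with n hn
  have hn' : 2 ≤ α * (N n : ℝ) := by
    rw [mul_comm]; exact (div_le_iff₀ hα0).mp hn
  have hNR : (0 : ℝ) < N n := by exact_mod_cast hNpos n
  have ha : ⌊α * (N n : ℝ)⌋₊ ≤ N n :=
    Nat.floor_le_of_le (mul_le_of_le_one_left hNR.le hα.2.le)
  have hfloor : α * (N n : ℝ) / 2 ≤ (⌊α * (N n : ℝ)⌋₊ : ℝ) := by
    have := Nat.lt_floor_add_one (α * (N n : ℝ))
    linarith
  have hone : 1 ≤ ENNReal.ofReal (2 / α) * ((N n : ℝ≥0∞)⁻¹ * (⌊α * (N n : ℝ)⌋₊ : ℝ≥0∞)) := by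
    rw [← ENNReal.ofReal_natCast (N n), ← ENNReal.ofReal_natCast ⌊α * (N n : ℝ)⌋₊,
      ← ENNReal.ofReal_inv_of_pos hNR, ← ENNReal.ofReal_mul (by positivity),
      ← ENNReal.ofReal_mul (by positivity), ENNReal.one_le_ofReal]
    calc (1 : ℝ) = 2 / α * ((N n : ℝ)⁻¹ * (α * (N n : ℝ) / 2)) := by field_simp
      _ ≤ _ := by gcongr
  calc (P n) {ω | ε ≤ kthLargest (Y n ω) ⌊α * (N n : ℝ)⌋₊}
      ≤ ENNReal.ofReal (2 / α) * ((N n : ℝ≥0∞)⁻¹ * (⌊α * (N n : ℝ)⌋₊ : ℝ≥0∞)) *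
          (P n) {ω | ε ≤ kthLargest (Y n ω) ⌊α * (N n : ℝ)⌋₊} := le_mul_of_one_le_left' hone
    _ ≤ _ := by
      rw [mul_assoc]
      gcongr
      exact mul_measure_le_kthLargest_le (P n) (hYmeas n) ha hε
end
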